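/- In every epistemic transition system, for every state w, every coalition C, and all formulas φ, ψ: if w ⊨ K_C S_∅ φ and w ⊨ H_C ψ, then w ⊨ H_C (φ ∧ ψ) (where φ ∧ ψ abbreviates ¬(φ → ¬ψ)). -/

import Mathlib

/-- An epistemic transition system over a set of agents `A` and
propositional variables `Var`. -/
structure ETS (A : Type) (Var : Type) where
  W : Type
  Sim : A → W → W → Prop
  sim_equiv : ∀ a, Equivalence (Sim a)
  V : Type
  V_nonempty : Nonempty V
  M : W → (A → V) → W → Prop
  M_serial : ∀ w s, ∃ w', M w s w'
  pi : Var → Set W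

/-- Formulas of the language Φ. -/
inductive Formula (A Var : Type) : Type
  | var : Var → Formula A Var
  | neg : Formula A Var → Formula A Var
  | imp : Formula A Var → Formula A Var → Formula A Var
  | know : Set A → Formula A Var → Formula A Var
  | strat : Set A → Formula A Var → Formula A Var
  | how : Set A → Formula A Var → Formula A Var

variable {A Var : Type}

/-- Indistinguishability by a coalition `C`. -/
def ETS.simC (T : ETS A Var) (C : Set A) (w₁ w₂ : T.W) : Prop :=
  ∀ a ∈ C, T.Sim a w₁ w₂

/-- `T.trans C s w u` : a transition from `w` to `u` is consistent with the
strategy profile `s` of coalition `C`. -/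
def ETS.trans (T : ETS A Var) (C : Set A) (s : C → T.V) (w u : T.W) : Prop :=
  ∃ s' : A → T.V, (∀ (a : A) (h : a ∈ C), s' a = s ⟨a, h⟩) ∧ T.M w s' u

/-- Satisfaction relation `w ⊨ φ`. -/
def ETS.Sat (T : ETS A Var) : T.W → Formula A Var → Prop
  | w, Formula.var p => w ∈ T.pi p
  | w, Formula.neg φ => ¬ T.Sat w φ
  | w, Formula.imp φ ψ => T.Sat w φ → T.Sat w ψ
  | w, Formula.know C φ => ∀ w', T.simC C w w' → T.Sat w' φ
  | w, Formula.strat C φ => ∃ s : C → T.V, ∀ w', T.trans C s w w' → T.Sat w' φ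
  | w, Formula.how C φ =>
      ∃ s : C → T.V, ∀ w' w'', T.simC C w w' → T.trans C s w' w'' → T.Sat w'' φ

/-- if `w ⊨ K_C S_∅ φ` and `w ⊨ H_C ψ`, then `w ⊨ H_C (φ ∧ ψ)`,
where `φ ∧ ψ` abbreviates `¬(φ → ¬ψ)`. -/
theorem know_strat_how_conj_valid {A Var : Type} [Fintype A]
    (T : ETS A Var) (w : T.W) (C : Set A) (φ ψ : Formula A Var)
    (h1 : T.Sat w (.know C (.strat (∅ : Set A) φ)))
    (h2 : T.Sat w (.how C ψ)) :
    T.Sat w (.how C (.neg (.imp φ (.neg ψ)))) := by 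
  simp only [ETS.Sat] at h1 h2 ⊢
  obtain ⟨s, hs⟩ := h2
  refine ⟨s, fun w' w'' hw ht himp => ?_⟩
  obtain ⟨t, htt⟩ := h1 w' hw
  refine himp (htt w'' ?_) (hs w' w'' hw ht)
  obtain ⟨s', _, hM⟩ := ht
  exact ⟨s', fun a h => absurd h (Set.notMem_empty a), hM⟩
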